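/- Let (n_k)_{k≥1} be a strictly increasing sequence of positive integers, let p(z) = exp((i/2) ∑_{k=1}^{∞} z^{n_k}/k²) on the open unit disc, and set r_k = e^{-1/n_k}. Then for every k ≥ 1, I_p(r_k) ≥ (π e^{-2}/2) · n_k²/k⁴. -/

import Mathlib

open Filter Set

/-- The integral mean `I_p(r) = ∫₀^{2π} |z p'(z)/p(z)|² dθ`, `z = r e^{iθ}`. -/
noncomputable def Ip (p : ℂ → ℂ) (r : ℝ) : ℝ :=
  ∫ θ in (0:ℝ)..(2 * Real.pi),
    ‖(↑r * Complex.exp (↑θ * Complex.I)) * deriv p (↑r * Complex.exp (↑θ * Complex.I)) /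
      p (↑r * Complex.exp (↑θ * Complex.I))‖ ^ 2

lemma integral_exp_int_mul_I (m : ℤ) :
    ∫ θ in (0:ℝ)..(2 * Real.pi), Complex.exp (m * Complex.I * θ) =
      if m = 0 then (2 * Real.pi : ℂ) else 0 := by
  split_ifs with h
  · simp [h]
  · have hm : (m * Complex.I : ℂ) ≠ 0 := by simp [h]
    rw [integral_exp_mul_complex hm]
    have : (m * Complex.I * ((2 * Real.pi : ℝ) : ℂ)) = m * (2 * Real.pi * Complex.I) := by
      push_cast; ring
    rw [this, Complex.exp_int_mul_two_pi_mul_I]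
    simp

/-- The Fourier coefficient of an absolutely convergent trigonometric series with distinct
frequencies. -/
lemma integral_tsum_exp_mul_exp_neg {n : ℕ → ℕ} (hn : Function.Injective n) {c : ℕ → ℂ}
    (hc : Summable fun j => ‖c j‖) (k : ℕ) :
    ∫ θ in (0:ℝ)..(2 * Real.pi), (∑' j, c j * Complex.exp (n j * Complex.I * θ)) *
      Complex.exp (-(n k * Complex.I * θ)) = 2 * Real.pi * c k := by
  have hnorm (m : ℕ) (θ : ℝ) : ‖Complex.exp (m * Complex.I * θ)‖ = 1 := by
    rw [Complex.norm_exp]; simp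
  have hnorm' (m : ℕ) (θ : ℝ) : ‖Complex.exp (-(m * Complex.I * θ))‖ = 1 := by
    rw [Complex.norm_exp]; simp
  have hs (θ : ℝ) : Summable fun j => c j * Complex.exp (n j * Complex.I * θ) :=
    Summable.of_norm (by simpa [hnorm] using hc)
  have key : HasSum (fun j => ∫ θ in (0:ℝ)..(2 * Real.pi),
      c j * Complex.exp (n j * Complex.I * θ) * Complex.exp (-(n k * Complex.I * θ)))
      (∫ θ in (0:ℝ)..(2 * Real.pi), (∑' j, c j * Complex.exp (n j * Complex.I * θ)) *
        Complex.exp (-(n k * Complex.I * θ))) := by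
    refine intervalIntegral.hasSum_integral_of_dominated_convergence (fun j _ => ‖c j‖)
      (fun j => ?_) (fun j => ?_) ?_ ?_ ?_
    · exact Continuous.aestronglyMeasurable (by fun_prop)
    · exact Filter.Eventually.of_forall fun θ _ => by simp only [norm_mul, hnorm, hnorm', mul_one, le_refl]
    · exact Filter.Eventually.of_forall fun _ _ => hc
    · exact intervalIntegrable_const
    · exact Filter.Eventually.of_forall fun θ _ => (hs θ).hasSum.mul_right _
  have hterm (j : ℕ) : ∫ θ in (0:ℝ)..(2 * Real.pi),
      c j * Complex.exp (n j * Complex.I * θ) * Complex.exp (-(n k * Complex.I * θ)) =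
      if j = k then 2 * Real.pi * c k else 0 := by
    have (θ : ℝ) : c j * Complex.exp (n j * Complex.I * θ) *
        Complex.exp (-(n k * Complex.I * θ)) =
        c j * Complex.exp (((n j - n k : ℤ) : ℂ) * Complex.I * θ) := by
      rw [mul_assoc, ← Complex.exp_add]
      push_cast
      ring_nf
    simp_rw [this]
    rw [intervalIntegral.integral_const_mul, integral_exp_int_mul_I]
    by_cases h : j = k
    · subst h; simp; ring
    · have : (n j - n k : ℤ) ≠ 0 := by
        rw [sub_ne_zero]
        exact_mod_cast fun h' => h (hn h')
      simp [h, this]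
  simp_rw [hterm] at key
  exact key.unique (hasSum_ite_eq k _)

/-- Bessel's inequality for one coefficient of an absolutely convergent trigonometric series. -/
lemma two_pi_mul_norm_sq_le_integral_norm_tsum_sq {n : ℕ → ℕ} (hn : Function.Injective n)
    {c : ℕ → ℂ} (hc : Summable fun j => ‖c j‖) (k : ℕ) :
    2 * Real.pi * ‖c k‖ ^ 2 ≤ ∫ θ in (0:ℝ)..(2 * Real.pi),
      ‖∑' j, c j * Complex.exp (n j * Complex.I * θ)‖ ^ 2 := by
  have hnorm (m : ℕ) (θ : ℝ) : ‖Complex.exp (m * Complex.I * θ)‖ = 1 := by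
    rw [Complex.norm_exp]; simp
  have hnorm' (m : ℕ) (θ : ℝ) : ‖Complex.exp (-(m * Complex.I * θ))‖ = 1 := by
    rw [Complex.norm_exp]; simp
  have hcont : Continuous fun θ : ℝ => ∑' j, c j * Complex.exp (n j * Complex.I * θ) :=
    continuous_tsum (fun j => by fun_prop) hc
      fun j θ => by simp only [norm_mul, hnorm, mul_one, le_refl]
  have hcoeff := integral_tsum_exp_mul_exp_neg hn hc k
  generalize hG : (fun θ : ℝ => ∑' j, c j * Complex.exp (n j * Complex.I * θ)) = G at hcont
  have hG' (θ : ℝ) : ∑' j, c j * Complex.exp (n j * Complex.I * θ) = G θ := congrFun hG θ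
  simp_rw [hG'] at hcoeff ⊢
  have hpt (θ : ℝ) : 2 * (star (c k) * (G θ * Complex.exp (-(n k * Complex.I * θ)))).re -
      ‖c k‖ ^ 2 ≤ ‖G θ‖ ^ 2 := by
    have h1 : ‖G θ‖ = ‖G θ * Complex.exp (-(n k * Complex.I * θ))‖ := by
      rw [norm_mul, hnorm', mul_one]
    rw [h1, Complex.sq_norm, Complex.sq_norm, Complex.normSq_apply, Complex.normSq_apply]
    generalize G θ * Complex.exp (-(n k * Complex.I * θ)) = w
    simp only [Complex.star_def, Complex.mul_re, Complex.conj_re, Complex.conj_im]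
    nlinarith [sq_nonneg (w.re - (c k).re), sq_nonneg (w.im - (c k).im)]
  have hre : ∫ θ in (0:ℝ)..(2 * Real.pi),
      (star (c k) * (G θ * Complex.exp (-(n k * Complex.I * θ)))).re =
      2 * Real.pi * ‖c k‖ ^ 2 := by
    have h := Complex.reCLM.intervalIntegral_comp_comm
      (f := fun θ : ℝ => star (c k) * (G θ * Complex.exp (-(n k * Complex.I * θ))))
      (a := 0) (b := 2 * Real.pi) (μ := MeasureTheory.volume)
      (Continuous.intervalIntegrable (by fun_prop) _ _)
    simp only [Complex.reCLM_apply] at h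
    rw [h, intervalIntegral.integral_const_mul, hcoeff, Complex.sq_norm, Complex.normSq_apply]
    simp
    ring
  have hmono := intervalIntegral.integral_mono (a := 0) (b := 2 * Real.pi)
    (μ := MeasureTheory.volume) Real.two_pi_pos.le
    (Continuous.intervalIntegrable (by fun_prop) _ _)
    (Continuous.intervalIntegrable (by fun_prop) _ _) hpt
  rw [intervalIntegral.integral_sub (Continuous.intervalIntegrable (by fun_prop) _ _)
    (Continuous.intervalIntegrable (by fun_prop) _ _), intervalIntegral.integral_const_mul,
    hre] at hmono
  simp at hmono
  linarith

lemma summable_one_div_nat_add_one_sq : Summable fun j : ℕ => 1 / ((j : ℝ) + 1) ^ 2 := by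
  have := (summable_nat_add_iff (f := fun j : ℕ => 1 / (j : ℝ) ^ 2) 1).2
    (Real.summable_one_div_nat_pow.2 one_lt_two)
  simpa using this

lemma norm_natCast_add_one (j : ℕ) : ‖(j : ℂ) + 1‖ = (j : ℝ) + 1 := by
  exact_mod_cast Complex.norm_natCast (j + 1)

/-- The logarithmic derivative `z p'(z) / p(z)` of
`p(z) = exp((i/2) ∑_{k≥1} z^{n_k}/k²)`. -/
lemma mul_deriv_exp_tsum_div {n : ℕ → ℕ} (hpos : ∀ k, 0 < n k) {z : ℂ} (hz : ‖z‖ < 1) :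
    z * deriv (fun z : ℂ =>
        Complex.exp (Complex.I / 2 * ∑' j : ℕ, z ^ n j / ((j : ℂ) + 1) ^ 2)) z /
      Complex.exp (Complex.I / 2 * ∑' j : ℕ, z ^ n j / ((j : ℂ) + 1) ^ 2) =
      ∑' j : ℕ, Complex.I / 2 * (n j * z ^ n j / ((j : ℂ) + 1) ^ 2) := by
  have hz' : z ∈ Metric.ball (0 : ℂ) 1 := by simpa using hz
  have hd (j : ℕ) : DifferentiableOn ℂ (fun w : ℂ => w ^ n j / ((j : ℂ) + 1) ^ 2)
      (Metric.ball 0 1) := by fun_prop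
  have hb (j : ℕ) (w : ℂ) (hw : w ∈ Metric.ball (0 : ℂ) 1) :
      ‖w ^ n j / ((j : ℂ) + 1) ^ 2‖ ≤ 1 / ((j : ℝ) + 1) ^ 2 := by
    rw [norm_div, norm_pow, norm_pow, norm_natCast_add_one]
    gcongr
    exact pow_le_one₀ (norm_nonneg _) ((mem_ball_zero_iff.1 hw).le)
  have hS := Complex.hasSum_deriv_of_summable_norm summable_one_div_nat_add_one_sq hd
    Metric.isOpen_ball hb hz'
  have hdiff := (Complex.differentiableOn_tsum_of_summable_norm summable_one_div_nat_add_one_sq hd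
    Metric.isOpen_ball hb).differentiableAt (Metric.isOpen_ball.mem_nhds hz')
  have hterm (j : ℕ) : Complex.I / 2 *
      (z * deriv (fun w : ℂ => w ^ n j / ((j : ℂ) + 1) ^ 2) z) =
      Complex.I / 2 * (n j * z ^ n j / ((j : ℂ) + 1) ^ 2) := by
    rw [deriv_div_const, deriv_pow_field]
    obtain ⟨m, hm⟩ := Nat.exists_eq_succ_of_ne_zero (hpos j).ne'
    rw [hm, Nat.succ_sub_one, Nat.succ_eq_add_one, pow_succ]
    ring
  have hsum := (hS.mul_left z).mul_left (Complex.I / 2)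
  simp_rw [hterm] at hsum
  rw [hsum.tsum_eq, ((hdiff.hasDerivAt.const_mul (Complex.I / 2)).cexp).deriv]
  field_simp [Complex.exp_ne_zero]

/-- For the lacunary function `p(z) = exp((i/2) ∑_{k≥1} z^{n_k}/k²)` and radii
`r_k = e^{-1/n_k}`: `I_p(r_k) ≥ (π e^{-2}/2) n_k²/k⁴` (indexed by `k+1`). -/
theorem stmt15 (n : ℕ → ℕ) (hmono : StrictMono n) (hpos : ∀ k, 0 < n k) (k : ℕ) :
    Real.pi * Real.exp (-2) / 2 * ((n k : ℝ) ^ 2 / ((k : ℝ) + 1) ^ 4) ≤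
      Ip (fun z : ℂ => Complex.exp (Complex.I / 2 * ∑' j : ℕ, z ^ n j / ((j : ℂ) + 1) ^ 2))
        (Real.exp (-(1 / (n k : ℝ)))) := by
  set r := Real.exp (-(1 / (n k : ℝ))) with hr
  have hnk : (0 : ℝ) < n k := by exact_mod_cast hpos k
  have hr0 : 0 < r := Real.exp_pos _
  have hr1 : r < 1 := by rw [hr, Real.exp_lt_one_iff]; simpa using hnk
  have hrk : (r ^ n k) ^ 2 = Real.exp (-2) := by
    rw [hr, ← Real.exp_nat_mul, ← Real.exp_nat_mul]
    congr 1
    field_simp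
    norm_num
  let c : ℕ → ℂ := fun j => Complex.I / 2 * (n j * (r : ℂ) ^ n j / ((j : ℂ) + 1) ^ 2)
  have hcn (j : ℕ) : ‖c j‖ = n j * r ^ n j / ((j : ℝ) + 1) ^ 2 / 2 := by
    simp only [c, norm_mul, norm_div, norm_pow, norm_natCast_add_one, Complex.norm_I,
      Complex.norm_natCast, Complex.norm_real, Real.norm_of_nonneg hr0.le, Complex.norm_two]
    ring
  have hc : Summable fun j => ‖c j‖ := by
    have h := (summable_pow_mul_geometric_of_norm_lt_one 1
      (by rwa [Real.norm_of_nonneg hr0.le] : ‖r‖ < 1)).comp_injective hmono.injective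
    refine h.of_nonneg_of_le (fun _ => norm_nonneg _) fun j => ?_
    rw [hcn, Function.comp_apply, pow_one, div_div]
    refine div_le_self (by positivity) ?_
    nlinarith [sq_nonneg (j : ℝ), (Nat.cast_nonneg j : (0 : ℝ) ≤ j)]
  have hI : Ip (fun z : ℂ => Complex.exp (Complex.I / 2 * ∑' j : ℕ, z ^ n j / ((j : ℂ) + 1) ^ 2))
      r = ∫ θ in (0:ℝ)..(2 * Real.pi), ‖∑' j, c j * Complex.exp (n j * Complex.I * θ)‖ ^ 2 := by
    refine intervalIntegral.integral_congr fun θ _ => ?_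
    have hz : ‖(r : ℂ) * Complex.exp (θ * Complex.I)‖ < 1 := by
      rwa [norm_mul, Complex.norm_exp_ofReal_mul_I, mul_one, Complex.norm_real,
        Real.norm_of_nonneg hr0.le]
    simp only [mul_deriv_exp_tsum_div hpos hz]
    congr 3 with j
    rw [mul_pow, ← Complex.exp_nat_mul]
    simp only [c]
    ring_nf
  rw [hI]
  refine le_trans (le_of_eq ?_) (two_pi_mul_norm_sq_le_integral_norm_tsum_sq hmono.injective hc k)
  rw [hcn, ← hrk]
  field_simp
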